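/- Let F be a family of k-subsets of an n-set that is 2-intersecting (any two members meet in at least 2 points) and also a coclique in J(n,k,{1}) trivially; if additionally n > (k-1)·(2 + 1) i.e. n ≥ 3k-2, then |F| ≤ C(n-2, k-2), with equality iff F is a 2-star. -/

import Mathlib

open Finset

namespace TwoIntersecting

/-- The scaled eigenvalue of the weighted disjointness operator on the harmonic space of
degree `e`. -/
noncomputable def theta (k m e : ℕ) : ℝ :=
  (-1) ^ e * (((k : ℝ) - e) * (m + 1 - e) - (k - 1) * (m - 1)) * ((m - e).choose (k - e) : ℕ)

/-- The negative of the least value of `theta`. -/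
noncomputable def gap (k m : ℕ) : ℝ := ((m : ℝ) - 1) * ((m - 2).choose (k - 2) : ℕ)

lemma sub_mul_choose_sub (e k m : ℕ) (hek : e < k) (hkm : k ≤ m) :
    ((m : ℝ) - e) * ((m - (e + 1)).choose (k - (e + 1)) : ℕ) =
      (k - e) * ((m - e).choose (k - e) : ℕ) := by
  have h := Nat.add_one_mul_choose_eq (m - (e + 1)) (k - (e + 1))
  rw [show m - (e + 1) + 1 = m - e by omega, show k - (e + 1) + 1 = k - e by omega] at h
  have h' := congrArg (Nat.cast : ℕ → ℝ) h
  push_cast [Nat.cast_sub hek.le, Nat.cast_sub (hek.le.trans hkm)] at h'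
  rw [h', mul_comm]

lemma gap_pos {k m : ℕ} (hk : 3 ≤ k) (hm : 2 * k ≤ m + 2) : 0 < gap k m := by
  have h : (1 : ℝ) < m := by exact_mod_cast (show 1 < m by omega)
  have h2 : (0 : ℝ) < ((m - 2).choose (k - 2) : ℕ) := by
    exact_mod_cast Nat.choose_pos (by omega)
  exact mul_pos (by linarith) h2

lemma theta_two (k m : ℕ) : theta k m 2 = -gap k m := by
  simp only [theta, gap]; push_cast; ring

lemma theta_one {k m : ℕ} (hk : 3 ≤ k) (hm : 2 * k ≤ m + 2) : theta k m 1 = -gap k m := by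
  have := sub_mul_choose_sub 1 k m (by omega) (by omega)
  simp only [theta, gap]
  push_cast at this ⊢
  linear_combination this

lemma theta_zero {k m : ℕ} (hk : 3 ≤ k) (hm : 2 * k ≤ m + 2) :
    (theta k m 0 + gap k m) * ((m + k - 2).choose (k - 2) : ℕ) =
      gap k m * ((m + k).choose k : ℕ) := by
  have h0 := sub_mul_choose_sub 0 k m (by omega) (by omega)
  have h1 := sub_mul_choose_sub 1 k m (by omega) (by omega)
  have g0 := sub_mul_choose_sub 0 k (m + k) (by omega) (by omega)
  have g1 := sub_mul_choose_sub 1 k (m + k) (by omega) (by omega)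
  simp only [theta, gap]
  have hk' : (3 : ℝ) ≤ k := by exact_mod_cast hk
  simp only [zero_add, Nat.sub_zero, Nat.reduceAdd] at *
  push_cast at *
  set a := ((m.choose k : ℕ) : ℝ)
  set b := (((m - 1).choose (k - 1) : ℕ) : ℝ)
  set c := (((m - 2).choose (k - 2) : ℕ) : ℝ)
  set x := (((m + k).choose k : ℕ) : ℝ)
  set y := (((m + k - 1).choose (k - 1) : ℕ) : ℝ)
  set z := (((m + k - 2).choose (k - 2) : ℕ) : ℝ)
  have ha : (k : ℝ) * (k - 1) * a = m * (m - 1) * c := by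
    linear_combination (-(k : ℝ) + 1) * h0 - (m : ℝ) * h1
  have hx : (k : ℝ) * (k - 1) * x = (m + k) * (m + k - 1) * z := by
    linear_combination (-(k : ℝ) + 1) * g0 - ((m : ℝ) + k) * g1
  have hne : (k : ℝ) * (k - 1) ≠ 0 := by
    have : (0 : ℝ) < k * (k - 1) := mul_pos (by linarith) (by linarith)
    exact this.ne'
  apply mul_left_cancel₀ hne
  linear_combination (m + 2 * k - 1 : ℝ) * z * ha - ((m : ℝ) - 1) * c * hx

lemma sub_mul_choose_lt_gap {k m e : ℕ} (he : 4 ≤ e) (hek : e ≤ k) (hm : 2 * k ≤ m + 2) :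
    (((k : ℝ) - 1) * (m - 1) - (k - e) * (m + 1 - e)) * ((m - e).choose (k - e) : ℕ) < gap k m := by
  have hm' : 2 * (k : ℝ) ≤ m + 2 := by exact_mod_cast hm
  induction e, he using Nat.le_induction with
  | base =>
    have h2 := sub_mul_choose_sub 2 k m (by omega) (by omega)
    have h3 := sub_mul_choose_sub 3 k m (by omega) (by omega)
    have hc : (0 : ℝ) < ((m - 2).choose (k - 2) : ℕ) := by
      exact_mod_cast Nat.choose_pos (by omega)
    have hk' : (4 : ℝ) ≤ k := by exact_mod_cast hek
    simp only [gap, Nat.reduceAdd] at *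
    push_cast at *
    set a := (((m - 2).choose (k - 2) : ℕ) : ℝ)
    set b := (((m - 3).choose (k - 3) : ℕ) : ℝ)
    set c := (((m - 4).choose (k - 4) : ℕ) : ℝ)
    have hmm : (6 : ℝ) ≤ m := by linarith
    have hcc : ((m : ℝ) - 2) * (m - 3) * c = (k - 2) * (k - 3) * a := by
      linear_combination ((m : ℝ) - 2) * h3 + ((k : ℝ) - 3) * h2
    have hpos : (0 : ℝ) < (m - 2) * (m - 3) := mul_pos (by linarith) (by linarith)
    apply lt_of_mul_lt_mul_left _ hpos.le
    have e1 : ((m : ℝ) - 2) * (m - 3) * (((k - 1) * (m - 1) - (k - 4) * (m + 1 - 4)) * c) =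
        (3 * m + 2 * k - 11) * ((k - 2) * (k - 3)) * a := by
      linear_combination (3 * m + 2 * k - 11 : ℝ) * hcc
    rw [e1]
    have e2 : ((m : ℝ) - 2) * (m - 3) * ((m - 1) * a) = (m - 1) * ((m - 2) * (m - 3)) * a := by ring
    rw [e2]
    apply mul_lt_mul_of_pos_right _ hc
    have b1 : (3 * m + 2 * k - 11 : ℝ) ≤ 4 * m - 9 := by linarith
    have b2 : ((k : ℝ) - 2) * (k - 3) ≤ ((m - 2) / 2) * ((m - 4) / 2) :=
      mul_le_mul (by linarith) (by linarith) (by linarith) (by linarith)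
    have b3 : (3 * m + 2 * k - 11 : ℝ) * ((k - 2) * (k - 3)) ≤
        (4 * m - 9) * (((m - 2) / 2) * ((m - 4) / 2)) :=
      mul_le_mul b1 b2 (mul_nonneg (by linarith) (by linarith)) (by linarith)
    refine b3.trans_lt ?_
    have b4 : (m - 9 / 4 : ℝ) * (m - 4) < (m - 1) * (m - 3) := by nlinarith
    have b5 := mul_lt_mul_of_pos_right b4 (show (0 : ℝ) < m - 2 by linarith)
    linarith
  | succ e he ih =>
    refine lt_of_le_of_lt ?_ (ih (by omega))
    have h := sub_mul_choose_sub e k m (by omega) (by omega)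
    have he' : (4 : ℝ) ≤ e := by exact_mod_cast he
    have hek' : (e : ℝ) + 1 ≤ k := by exact_mod_cast hek
    set a := (((m - e).choose (k - e) : ℕ) : ℝ) with ha
    set b := (((m - (e + 1)).choose (k - (e + 1)) : ℕ) : ℝ) with hb
    have ha0 : 0 ≤ a := by positivity
    have hb0 : 0 ≤ b := by positivity
    have hme : (0 : ℝ) < m - e := by linarith
    have hab : 2 * b ≤ a := by
      apply le_of_mul_le_mul_left _ hme
      have : (2 * ((k : ℝ) - e)) * a ≤ (m - e) * a :=
        mul_le_mul_of_nonneg_right (by linarith) ha0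
      linarith
    push_cast
    set D : ℝ := (k - 1) * (m - 1) - (k - e) * (m + 1 - e) with hD
    have hD0 : 0 ≤ D := by
      have : ((k : ℝ) - e) * (m + 1 - e) ≤ (k - 1) * (m - 1) :=
        mul_le_mul (by linarith) (by linarith) (by linarith) (by linarith)
      linarith
    have hDD : ((k : ℝ) - 1) * (m - 1) - (k - (e + 1)) * (m + 1 - (e + 1)) ≤ 2 * D := by
      rw [hD]
      have hm2 : 2 * (e : ℝ) ≤ m := by linarith
      nlinarith [mul_nonneg (show (0 : ℝ) ≤ e - 2 by linarith) (show (0 : ℝ) ≤ m - 2 * e by linarith),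
        mul_nonneg (show (0 : ℝ) ≤ e - 3 by linarith) (show (0 : ℝ) ≤ k - (e + 1) by linarith)]
    calc _ ≤ 2 * D * b := mul_le_mul_of_nonneg_right hDD hb0
      _ = D * (2 * b) := by ring
      _ ≤ D * a := mul_le_mul_of_nonneg_left hab hD0

lemma neg_gap_lt_theta {k m e : ℕ} (he : 3 ≤ e) (hek : e ≤ k) (hm : 2 * k ≤ m + 2) :
    -gap k m < theta k m e := by
  have hg := gap_pos (he.trans hek) hm
  have he' : (3 : ℝ) ≤ e := by exact_mod_cast he
  have hek' : (e : ℝ) ≤ k := by exact_mod_cast hek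
  have hm' : 2 * (k : ℝ) ≤ m + 2 := by exact_mod_cast hm
  rcases Nat.even_or_odd e with hev | hodd
  · have h4 : 4 ≤ e := by
      rcases hev with ⟨r, rfl⟩; omega
    have := sub_mul_choose_lt_gap h4 hek hm
    rw [theta, hev.neg_one_pow]
    linarith
  · rw [theta, hodd.neg_one_pow]
    have h1 : ((k : ℝ) - e) * (m + 1 - e) ≤ (k - 1) * (m - 1) :=
      mul_le_mul (by linarith) (by linarith) (by linarith) (by linarith)
    have h2 : (0 : ℝ) ≤ -1 * (((k : ℝ) - e) * (m + 1 - e) - (k - 1) * (m - 1)) *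
        ((m - e).choose (k - e) : ℕ) := mul_nonneg (by linarith) (by positivity)
    linarith

variable {α : Type*} [DecidableEq α]

/-- The sum of `h` over all subsets of `A`. -/
def lift (h : Finset α → ℝ) (A : Finset α) : ℝ := ∑ S ∈ A.powerset, h S

/-- `h` vanishes off the `e`-subsets. -/
def SupportedOn (e : ℕ) (h : Finset α → ℝ) : Prop := ∀ S, S.card ≠ e → h S = 0

lemma sum_powersetCard_lift {e j : ℕ} {h : Finset α → ℝ} (hs : SupportedOn e h) (hej : e ≤ j)
    (A : Finset α) :
    ∑ Q ∈ A.powersetCard j, lift h Q = ((A.card - e).choose (j - e) : ℕ) * lift h A := by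
  simp only [lift]
  rw [sum_comm' (t' := A.powerset) (s' := fun S => (A.powersetCard j).filter (fun Q => S ⊆ Q)),
    mul_sum]
  · refine sum_congr rfl fun S hS => ?_
    rw [sum_const, nsmul_eq_mul]
    by_cases hc : S.card = e
    · rw [card_filter_powersetCard_subset S A j (mem_powerset.1 hS) (by omega), hc]
    · rw [hs S hc]; simp
  · intro Q S
    simp only [mem_powersetCard, mem_powerset, mem_filter]
    constructor
    · rintro ⟨⟨h1, h2⟩, h3⟩
      exact ⟨⟨⟨h1, h2⟩, h3⟩, h3.trans h1⟩
    · rintro ⟨⟨⟨h1, h2⟩, h3⟩, _⟩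
      exact ⟨⟨h1, h2⟩, h3⟩

lemma sum_lift_erase {e : ℕ} {h : Finset α → ℝ} (hs : SupportedOn e h) (A : Finset α) :
    ∑ x ∈ A, lift h (A.erase x) = ((A.card : ℝ) - e) * lift h A := by
  simp only [lift]
  rw [sum_comm' (t' := A.powerset) (s' := fun S => A \ S), mul_sum]
  · refine sum_congr rfl fun S hS => ?_
    rw [sum_const, nsmul_eq_mul]
    by_cases hc : S.card = e
    · rw [cast_card_sdiff (mem_powerset.1 hS), hc]
    · rw [hs S hc]; simp
  · intro x S
    simp only [mem_powerset, mem_sdiff, subset_erase]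
    tauto

omit [DecidableEq α] in
lemma lift_eq_self {e : ℕ} {h : Finset α → ℝ} (hs : SupportedOn e h) {A : Finset α}
    (hA : A.card ≤ e) : lift h A = h A := by
  refine sum_eq_single A (fun S hS hne => hs S ?_) (by simp)
  have := card_lt_card (ssubset_of_subset_of_ne (mem_powerset.1 hS) hne)
  omega

/-- The total weight of the pairs joining `x` to `Z`. -/
def pairDegree (w : Finset α → ℝ) (x : α) (Z : Finset α) : ℝ := ∑ y ∈ Z, w {x, y}

lemma lift_insert {w : Finset α → ℝ} (hw : SupportedOn 2 w) {x : α} {Z : Finset α} (hx : x ∉ Z) :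
    lift w (insert x Z) = lift w Z + pairDegree w x Z := by
  rw [lift, sum_powerset_insert hx, lift, pairDegree]
  congr 1
  symm
  refine sum_of_injOn (fun y => {y}) (fun y _ z _ hyz => singleton_injective hyz) ?_ ?_ ?_
  · intro y hy; simpa using hy
  · intro S hS hS'
    apply hw
    have hxS : x ∉ S := fun h => hx (mem_powerset.1 hS h)
    rw [card_insert_of_notMem hxS]
    intro hc
    obtain ⟨y, rfl⟩ := card_eq_one.1 (show S.card = 1 by omega)
    exact hS' ⟨y, by simpa using hS, rfl⟩
  · intro y _; rfl

lemma pairDegree_insert {w : Finset α → ℝ} (x : α) {y : α} {Z : Finset α} (hy : y ∉ Z) :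
    pairDegree w x (insert y Z) = w {x, y} + pairDegree w x Z := sum_insert hy

lemma pairDegree_insert_self {w : Finset α → ℝ} (hw : SupportedOn 2 w) (x : α) {Z : Finset α}
    (hx : x ∉ Z) : pairDegree w x (insert x Z) = pairDegree w x Z := by
  rw [pairDegree_insert x hx, hw {x, x} (by simp), zero_add]

lemma lift_eq_lift_erase_add {w : Finset α → ℝ} (hw : SupportedOn 2 w) {x : α} {A : Finset α}
    (hx : x ∈ A) : lift w A = lift w (A.erase x) + pairDegree w x A := by
  conv_lhs => rw [← insert_erase hx]
  rw [lift_insert hw (notMem_erase x A), ← pairDegree_insert_self hw x (notMem_erase x A),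
    insert_erase hx]

lemma sum_pairDegree {w : Finset α → ℝ} (hw : SupportedOn 2 w) (Z : Finset α) :
    ∑ x ∈ Z, pairDegree w x Z = 2 * lift w Z := by
  have h1 := sum_congr (f := fun x => pairDegree w x Z)
    (g := fun x => lift w Z - lift w (Z.erase x)) (rfl : Z = Z)
    fun x hx => by have := lift_eq_lift_erase_add hw hx; linarith
  rw [h1, sum_sub_distrib, sum_lift_erase hw, sum_const, nsmul_eq_mul]
  push_cast; ring

variable [Fintype α]

/-- `h` is a function on `e`-sets whose sums over the `e`-sets containing a fixed smaller set all
vanish. -/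
structure IsHarmonic (e : ℕ) (h : Finset α → ℝ) : Prop where
  supported : SupportedOn e h
  sum_superset : ∀ Q : Finset α, Q.card < e → ∑ S with Q ⊆ S, h S = 0

lemma IsHarmonic.lift_compl {e : ℕ} {h : Finset α → ℝ} (hh : IsHarmonic e h) (T : Finset α) :
    lift h Tᶜ = (-1) ^ e * lift h T := by
  have key : ∀ S : Finset α, (if S ⊆ Tᶜ then h S else 0) =
      ∑ Q ∈ T.powerset, if Q ⊆ S then (-1 : ℝ) ^ Q.card * h S else 0 := by
    intro S
    rw [← sum_filter, ← sum_mul]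
    have h1 : T.powerset.filter (fun Q => Q ⊆ S) = (T ∩ S).powerset := by
      ext Q; simp only [mem_filter, mem_powerset, subset_inter_iff]
    have h2 := congrArg (Int.cast : ℤ → ℝ) (sum_powerset_neg_one_pow_card (x := T ∩ S))
    push_cast at h2
    rw [h1, h2, ite_mul, one_mul, zero_mul]
    exact if_congr (by rw [subset_compl_iff_disjoint_left, disjoint_iff_inter_eq_empty]) rfl rfl
  have h1 : lift h Tᶜ = ∑ S, if S ⊆ Tᶜ then h S else 0 := by
    rw [← sum_filter]
    exact sum_congr (by ext; simp) fun _ _ => rfl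
  rw [h1, sum_congr rfl fun S _ => key S, sum_comm, lift, mul_sum]
  refine sum_congr rfl fun Q _ => ?_
  rw [← sum_filter, ← mul_sum]
  rcases lt_trichotomy Q.card e with hlt | heq | hgt
  · rw [hh.sum_superset Q hlt, hh.supported Q hlt.ne]; simp
  · rw [heq, sum_eq_single_of_mem Q (by simp)]
    intro S hS hne
    have := card_lt_card (ssubset_of_subset_of_ne (by simpa using hS) hne.symm)
    exact hh.supported S (by omega)
  · rw [hh.supported Q hgt.ne', sum_eq_zero, mul_zero, mul_zero]
    intro S hS
    have := card_le_card (show Q ⊆ S by simpa using hS)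
    exact hh.supported S (by omega)

lemma IsHarmonic.lift_eq_zero {e : ℕ} {h : Finset α → ℝ} (hh : IsHarmonic e h) {T : Finset α}
    (hT : T.card < e) : lift h T = 0 := by
  rw [lift_eq_self hh.supported hT.le, hh.supported T hT.ne]

lemma IsHarmonic.sum_compl_lift {e k : ℕ} {h : Finset α → ℝ} (hh : IsHarmonic e h) (hek : e ≤ k)
    (T : Finset α) :
    ∑ B ∈ (Tᶜ).powersetCard k, lift h B =
      (-1) ^ e * ((Tᶜ.card - e).choose (k - e) : ℕ) * lift h T := by
  rw [sum_powersetCard_lift hh.supported hek, hh.lift_compl]; ring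

lemma IsHarmonic.sum_lift_mul_lift {e e' k : ℕ} {h h' : Finset α → ℝ} (hh : IsHarmonic e h)
    (hh' : IsHarmonic e' h') (hlt : e < e') (hk : e' ≤ k) :
    ∑ A ∈ (univ : Finset α).powersetCard k, lift h A * lift h' A = 0 := by
  have h1 : ∀ A : Finset α, lift h A = (-1) ^ e * lift h Aᶜ := by
    intro A
    conv_lhs => rw [← compl_compl A]
    exact hh.lift_compl Aᶜ
  rw [sum_congr rfl fun A _ => by rw [h1 A, mul_assoc], ← mul_sum]
  rw [mul_eq_zero]; right
  simp only [lift, sum_mul]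
  rw [sum_comm' (t' := univ) (s' := fun S => Sᶜ.powersetCard k)]
  · refine sum_eq_zero fun S _ => ?_
    by_cases hc : S.card = e
    · have := hh'.sum_compl_lift hk S
      rw [← mul_sum]
      simp only [lift] at this
      rw [this]
      have h0 := hh'.lift_eq_zero (T := S) (by omega)
      simp only [lift] at h0
      rw [h0]; simp
    · simp [hh.supported S hc]
  · intro A S
    simp only [mem_powersetCard, mem_powerset, mem_univ, subset_univ, true_and, and_true]
    rw [subset_compl_comm]; tauto

lemma exists_eq_add_isHarmonic (k : ℕ) (f : Finset α → ℝ) :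
    ∃ g h : Finset α → ℝ, IsHarmonic (k + 1) h ∧
      ∀ A : Finset α, A.card = k + 1 → f A = h A + ∑ S ∈ A.powersetCard k, g S := by
  let U : (Finset α → ℝ) →ₗ[ℝ] EuclideanSpace ℝ (Finset α) :=
    { toFun := fun g => WithLp.toLp 2 fun A =>
        if A.card = k + 1 then ∑ S ∈ A.powersetCard k, g S else 0
      map_add' := by
        intro g g'; ext A; simp only [Pi.add_apply, PiLp.add_apply]
        split_ifs <;> simp [sum_add_distrib]
      map_smul' := by
        intro c g; ext A; simp [mul_sum] }
  let f' : EuclideanSpace ℝ (Finset α) := WithLp.toLp 2 fun A => if A.card = k + 1 then f A else 0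
  obtain ⟨y, ⟨g, rfl⟩, z, hz, hfz⟩ := Submodule.exists_add_mem_mem_orthogonal
    (K := LinearMap.range U) f'
  have hval : ∀ A, f' A = U g A + z A := fun A => by rw [hfz]; rfl
  have hsupp : SupportedOn (k + 1) (fun A => z A) := by
    intro A hA
    have := hval A
    simpa [f', U, hA] using this.symm
  have hk : ∀ S : Finset α, S.card = k → ∑ A with S ⊆ A, z A = 0 := by
    intro S hS
    have h1 := hz (U (Pi.single S 1)) ⟨_, rfl⟩
    rw [PiLp.inner_apply] at h1
    rw [← h1, sum_filter]
    refine sum_congr rfl fun A _ => ?_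
    by_cases hA : A.card = k + 1
    · simp [U, hA, Pi.single_apply, hS]
    · rw [show z A = 0 from hsupp A hA]
      simp
  refine ⟨g, fun A => z A, ⟨hsupp, ?_⟩, ?_⟩
  · intro Q hQ
    have h2 : ∑ S with Q ⊆ S ∧ S.card = k, ∑ A with S ⊆ A, z A = 0 :=
      sum_eq_zero fun S hS => hk S (mem_filter.1 hS).2.2
    rw [sum_comm' (t' := univ.filter fun A => Q ⊆ A)
      (s' := fun A => (A.powersetCard k).filter fun S => Q ⊆ S)] at h2
    · have h3 : ∀ A ∈ univ.filter (fun A : Finset α => Q ⊆ A),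
          ∑ S ∈ (A.powersetCard k).filter (fun S => Q ⊆ S), z A =
            ((k + 1 - Q.card).choose (k - Q.card) : ℕ) * z A := by
        intro A hA
        rw [sum_const, nsmul_eq_mul]
        by_cases hc : A.card = k + 1
        · rw [card_filter_powersetCard_subset Q A k (by simpa using hA) (by omega), hc]
        · rw [show z A = 0 from hsupp A hc]
          simp
      rw [sum_congr rfl h3, ← mul_sum, mul_eq_zero] at h2
      refine h2.resolve_left ?_
      exact_mod_cast (Nat.choose_pos (by omega)).ne'
    · intro S A
      simp only [mem_filter, mem_univ, true_and, mem_powersetCard]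
      constructor
      · rintro ⟨⟨h1, h2⟩, h3⟩; exact ⟨⟨⟨h3, h2⟩, h1⟩, h1.trans h3⟩
      · rintro ⟨⟨⟨h1, h2⟩, h3⟩, _⟩; exact ⟨⟨h3, h2⟩, h1⟩
  · intro A hA
    have := hval A
    simp only [f', U, LinearMap.coe_mk, AddHom.coe_mk, hA, if_true] at this
    rw [this, add_comm]

lemma isHarmonic_zero (e : ℕ) : IsHarmonic e (0 : Finset α → ℝ) :=
  ⟨fun _ _ => rfl, fun _ _ => by simp⟩

lemma IsHarmonic.const_mul {e : ℕ} {h : Finset α → ℝ} (hh : IsHarmonic e h) (c : ℝ) :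
    IsHarmonic e (fun S => c * h S) :=
  ⟨fun S hS => by simp [hh.supported S hS], fun Q hQ => by
    rw [← mul_sum, hh.sum_superset Q hQ, mul_zero]⟩

lemma exists_harmonic_decomposition (k : ℕ) (f : Finset α → ℝ) :
    ∃ h : ℕ → Finset α → ℝ, (∀ e, IsHarmonic e (h e)) ∧
      ∀ A : Finset α, A.card = k → f A = ∑ e ∈ range (k + 1), lift (h e) A := by
  induction k generalizing f with
  | zero =>
    refine ⟨fun e => if e = 0 then Pi.single ∅ (f ∅) else 0, fun e => ?_, ?_⟩
    · dsimp only
      split_ifs with he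
      · subst he
        refine ⟨fun S hS => ?_, fun Q hQ => by omega⟩
        rw [Pi.single_apply, if_neg]
        rintro rfl; simp at hS
      · exact isHarmonic_zero e
    · intro A hA
      obtain rfl := card_eq_zero.1 hA
      simp [lift]
  | succ k ih =>
    obtain ⟨g, h', hh', hf⟩ := exists_eq_add_isHarmonic k f
    obtain ⟨h, hh, hg⟩ := ih g
    refine ⟨fun e => if e = k + 1 then h' else fun S => ((k + 1 - e : ℕ) : ℝ) * h e S, fun e => ?_, ?_⟩
    · dsimp only
      split_ifs with he
      · subst he; exact hh'
      · exact (hh e).const_mul _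
    · intro A hA
      rw [hf A hA, sum_range_succ]
      dsimp only
      rw [if_pos rfl, lift_eq_self hh'.supported hA.le, add_comm]
      congr 1
      rw [sum_congr rfl fun S hS => hg S (mem_powersetCard.1 hS).2, sum_comm]
      refine sum_congr rfl fun e he => ?_
      have hek := mem_range.1 he
      rw [if_neg (by omega), sum_powersetCard_lift (hh e).supported (by omega), hA]
      have h1 : (k + 1 - e).choose (k - e) = k + 1 - e := by
        rw [show k + 1 - e = (k - e) + 1 by omega]; simp
      rw [h1, lift, lift, mul_sum]

/-- The weighted disjointness operator on functions on `k`-sets. -/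
noncomputable def disjOp (k m : ℕ) (f : Finset α → ℝ) (A : Finset α) : ℝ :=
  ((m : ℝ) + 1 - k) * ∑ x ∈ A, ∑ B ∈ (A.erase x)ᶜ.powersetCard k, f B -
    ((k : ℝ) - 1) * (m - 1) * ∑ B ∈ Aᶜ.powersetCard k, f B

lemma disjOp_lift {k m e : ℕ} (hα : Fintype.card α = m + k) (hkm : k ≤ m) {h : Finset α → ℝ}
    (hh : IsHarmonic e h) (hek : e ≤ k) {A : Finset α} (hA : A.card = k) :
    disjOp k m (lift h) A = theta k m e * lift h A := by
  have hc : Aᶜ.card = m := by rw [card_compl, hα, hA]; omega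
  have hc' : ∀ x ∈ A, (A.erase x)ᶜ.card = m + 1 := fun x hx => by
    have := card_pos.2 ⟨x, hx⟩
    rw [card_compl, hα, card_erase_of_mem hx, hA]; omega
  have h1 := congrArg (Nat.cast : ℕ → ℝ) (Nat.choose_mul_succ_eq (m - e) (k - e))
  rw [show m - e + 1 = m + 1 - e by omega, show m + 1 - e - (k - e) = m + 1 - k by omega] at h1
  push_cast [Nat.cast_sub (show e ≤ m + 1 by omega), Nat.cast_sub (show k ≤ m + 1 by omega)] at h1
  rw [disjOp, hh.sum_compl_lift hek, hc, sum_congr rfl fun x hx => by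
    rw [hh.sum_compl_lift hek, hc' x hx], ← mul_sum, sum_lift_erase hh.supported, hA, theta]
  linear_combination (-(-1) ^ e * ((k : ℝ) - e) * lift h A) * h1

lemma disjOp_sum {ι : Type*} (s : Finset ι) (k m : ℕ) (f : ι → Finset α → ℝ) (A : Finset α) :
    disjOp k m (fun B => ∑ i ∈ s, f i B) A = ∑ i ∈ s, disjOp k m (f i) A := by
  simp only [disjOp, sum_sub_distrib, ← mul_sum]
  congr 2
  · rw [sum_comm]
    exact sum_congr rfl fun x _ => sum_comm
  · exact sum_comm

lemma disjOp_congr {k m : ℕ} {f g : Finset α → ℝ} (hfg : ∀ B, B.card = k → f B = g B)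
    (A : Finset α) : disjOp k m f A = disjOp k m g A := by
  have : ∀ T : Finset α, ∑ B ∈ T.powersetCard k, f B = ∑ B ∈ T.powersetCard k, g B := fun T =>
    sum_congr rfl fun B hB => hfg B (mem_powersetCard.1 hB).2
  simp only [disjOp, this]

lemma sum_mul_sum_lift {k : ℕ} {h : ℕ → Finset α → ℝ} (hh : ∀ e, IsHarmonic e (h e))
    (c : ℕ → ℝ) :
    ∑ A ∈ (univ : Finset α).powersetCard k, (∑ e ∈ range (k + 1), lift (h e) A) *
        (∑ e ∈ range (k + 1), c e * lift (h e) A) =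
      ∑ e ∈ range (k + 1), c e * ∑ A ∈ (univ : Finset α).powersetCard k, lift (h e) A ^ 2 := by
  simp only [sum_mul_sum]
  rw [sum_comm]
  refine sum_congr rfl fun e he => ?_
  rw [sum_comm, sum_eq_single_of_mem e he]
  · rw [mul_sum]; exact sum_congr rfl fun A _ => by ring
  · intro e' he' hne
    have h0 : ∑ A ∈ (univ : Finset α).powersetCard k, lift (h e) A * lift (h e') A = 0 := by
      simp only [mem_range] at he he'
      rcases lt_or_gt_of_ne hne with hlt | hgt
      · rw [← (hh e').sum_lift_mul_lift (k := k) (hh e) hlt (by omega)]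
        exact sum_congr rfl fun A _ => mul_comm _ _
      · exact (hh e).sum_lift_mul_lift (hh e') hgt (by omega)
    rw [sum_congr rfl fun A _ => mul_left_comm _ _ _, ← mul_sum, h0, mul_zero]

/-- The indicator function of a family of sets. -/
def indicator (F : Finset (Finset α)) (A : Finset α) : ℝ := if A ∈ F then 1 else 0

omit [Fintype α] in
lemma indicator_of_mem {F : Finset (Finset α)} {A : Finset α} (h : A ∈ F) : indicator F A = 1 :=
  if_pos h

omit [Fintype α] in
lemma indicator_of_notMem {F : Finset (Finset α)} {A : Finset α} (h : A ∉ F) :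
    indicator F A = 0 := if_neg h

lemma sum_indicator_compl_eq_zero {F : Finset (Finset α)}
    (hint : ∀ A ∈ F, ∀ B ∈ F, 2 ≤ (A ∩ B).card) (k : ℕ) {A : Finset α} (hA : A ∈ F)
    {Y : Finset α} (hY : (A \ Y).card ≤ 1) :
    ∑ B ∈ Yᶜ.powersetCard k, indicator F B = 0 := by
  refine sum_eq_zero fun B hB => indicator_of_notMem fun hBF => ?_
  have h1 : A ∩ B ⊆ A \ Y := fun x hx =>
    mem_sdiff.2 ⟨(mem_inter.1 hx).1, mem_compl.1 ((mem_powersetCard.1 hB).1 (mem_inter.1 hx).2)⟩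
  have := card_le_card h1
  have := hint A hA B hBF
  omega

lemma disjOp_indicator {F : Finset (Finset α)} (hint : ∀ A ∈ F, ∀ B ∈ F, 2 ≤ (A ∩ B).card)
    (k m : ℕ) {A : Finset α} (hA : A ∈ F) : disjOp k m (indicator F) A = 0 := by
  rw [disjOp, sum_indicator_compl_eq_zero hint k hA (by simp), sum_eq_zero, mul_zero, mul_zero,
    sub_zero]
  intro x hx
  exact sum_indicator_compl_eq_zero hint k hA (by rw [sdiff_erase_self hx]; simp)

omit [Fintype α] in
lemma exists_lift_eq_sum {k : ℕ} (hk : 2 ≤ k) {h : ℕ → Finset α → ℝ}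
    (hh : ∀ e, SupportedOn e (h e)) :
    ∃ w : Finset α → ℝ, SupportedOn 2 w ∧
      ∀ A : Finset α, A.card = k → lift w A = ∑ e ∈ range 3, lift (h e) A := by
  refine ⟨fun S => if S.card = 2 then
    ∑ e ∈ range 3, (((k - e).choose (2 - e) : ℕ) : ℝ)⁻¹ * lift (h e) S else 0,
    fun S hS => if_neg hS, fun A hA => ?_⟩
  rw [lift, ← sum_filter, ← powersetCard_eq_filter, sum_comm]
  refine sum_congr rfl fun e he => ?_
  have he := mem_range.1 he
  rw [← mul_sum, sum_powersetCard_lift (hh e) (by omega), hA, inv_mul_cancel_left₀]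
  exact_mod_cast (Nat.choose_pos (by omega)).ne'

lemma card_le_and_exists_lift {k m : ℕ} (hk : 3 ≤ k) (hm : 2 * k ≤ m + 2)
    (hα : Fintype.card α = m + k) {F : Finset (Finset α)} (hcard : ∀ A ∈ F, A.card = k)
    (hint : ∀ A ∈ F, ∀ B ∈ F, 2 ≤ (A ∩ B).card) :
    F.card ≤ (m + k - 2).choose (k - 2) ∧ (F.card = (m + k - 2).choose (k - 2) →
      ∃ w : Finset α → ℝ, SupportedOn 2 w ∧
        ∀ A : Finset α, A.card = k → indicator F A = lift w A) := by
  obtain ⟨h, hh, hf⟩ := exists_harmonic_decomposition k (indicator F)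
  set N : ℕ → ℝ := fun e => ∑ A ∈ (univ : Finset α).powersetCard k, lift (h e) A ^ 2 with hN
  have hN0 : ∀ e, 0 ≤ N e := fun e => sum_nonneg fun A _ => sq_nonneg _
  have hF : F ⊆ (univ : Finset α).powersetCard k := fun A hA =>
    mem_powersetCard.2 ⟨subset_univ _, hcard A hA⟩
  have hsum : ∑ A ∈ (univ : Finset α).powersetCard k, indicator F A = F.card := by
    simp only [indicator]
    rw [← sum_filter, filter_mem_eq_inter, inter_eq_right.2 hF]; simp
  have hnorm : ∑ e ∈ range (k + 1), N e = F.card := by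
    have h1 := sum_mul_sum_lift (k := k) hh fun _ => 1
    simp only [one_mul] at h1
    rw [hN, ← h1, ← hsum]
    refine sum_congr rfl fun A hA => ?_
    rw [← hf A (mem_powersetCard.1 hA).2, indicator]
    split_ifs <;> simp
  have hquad : ∑ e ∈ range (k + 1), theta k m e * N e = 0 := by
    rw [hN, ← sum_mul_sum_lift hh]
    refine sum_eq_zero fun A hA => ?_
    have hAk := (mem_powersetCard.1 hA).2
    rw [← hf A hAk]
    by_cases hAF : A ∈ F
    · have h1 := disjOp_indicator hint k m hAF
      rw [disjOp_congr hf, disjOp_sum, sum_congr rfl fun e he => disjOp_lift hα (by omega) (hh e)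
        (Nat.lt_succ_iff.1 (mem_range.1 he)) hAk] at h1
      rw [h1, mul_zero]
    · rw [indicator_of_notMem hAF, zero_mul]
  have hzero : ∀ A, lift (h 0) A = h 0 ∅ := fun A =>
    sum_eq_single_of_mem ∅ (by simp) fun S _ hS =>
      (hh 0).supported S (card_ne_zero.2 (nonempty_iff_ne_empty.2 hS))
  have hcx : (F.card : ℝ) = ((m + k).choose k : ℕ) * h 0 ∅ := by
    rw [← hsum, sum_congr rfl fun A hA => hf A (mem_powersetCard.1 hA).2, sum_comm,
      sum_eq_single_of_mem 0 (by simp)]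
    · simp [hzero, hα]
    · intro e he he0
      rw [sum_powersetCard_lift (hh e).supported (Nat.lt_succ_iff.1 (mem_range.1 he)),
        ← compl_empty, (hh e).lift_compl,
        (hh e).lift_eq_zero (T := ∅) (by simpa using Nat.pos_of_ne_zero he0), mul_zero, mul_zero]
  have hN_zero : N 0 = F.card * h 0 ∅ := by
    simp only [hN, hzero, sum_const, card_powersetCard, card_univ, hα, nsmul_eq_mul, hcx]
    ring
  have htotal : (theta k m 0 + gap k m) * N 0 +
      ∑ e ∈ Ico 3 (k + 1), (theta k m e + gap k m) * N e = gap k m * F.card := by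
    have h1 : ∑ e ∈ range (k + 1), (theta k m e + gap k m) * N e = gap k m * F.card := by
      simp only [add_mul, sum_add_distrib, ← mul_sum, hquad, hnorm, zero_add]
    rw [← h1, ← sum_range_add_sum_Ico _ (show 3 ≤ k + 1 by omega)]
    simp only [sum_range_succ, sum_range_zero, theta_one hk hm, theta_two]
    ring
  have hterm : ∀ e ∈ Ico 3 (k + 1), 0 ≤ (theta k m e + gap k m) * N e := fun e he => by
    have := neg_gap_lt_theta (mem_Ico.1 he).1 (Nat.lt_succ_iff.1 (mem_Ico.1 he).2) hm
    exact mul_nonneg (by linarith) (hN0 e)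
  have hrest := sum_nonneg hterm
  have hg := gap_pos hk hm
  have ht0 := theta_zero hk hm
  set R := ∑ e ∈ Ico 3 (k + 1), (theta k m e + gap k m) * N e
  set z := (m + k - 2).choose (k - 2)
  have hz : (0 : ℝ) < z := by exact_mod_cast Nat.choose_pos (by omega)
  have hmain : gap k m * ((F.card : ℝ) * F.card) + R * z = gap k m * (F.card * z) := by
    rw [hN_zero] at htotal
    linear_combination (z : ℝ) * htotal - (F.card : ℝ) * h 0 ∅ * ht0 +
      gap k m * F.card * hcx
  constructor
  · by_contra! hlt
    have hlt' : (z : ℝ) < F.card := by exact_mod_cast hlt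
    have h1 := mul_lt_mul_of_pos_left (mul_lt_mul_of_pos_left hlt' (hz.trans hlt')) hg
    have h2 := mul_nonneg hrest hz.le
    linarith
  · intro heq
    have hR : R = 0 := by
      rw [heq] at hmain
      have : R * z = 0 := by linarith
      exact (mul_eq_zero.1 this).resolve_right hz.ne'
    obtain ⟨w, hw, hwl⟩ := exists_lift_eq_sum (show 2 ≤ k by omega) fun e => (hh e).supported
    refine ⟨w, hw, fun A hA => ?_⟩
    rw [hf A hA, hwl A hA, ← sum_range_add_sum_Ico _ (show 3 ≤ k + 1 by omega),
      sum_eq_zero (s := Ico _ _),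
      add_zero]
    intro e he
    have h1 := (sum_eq_zero_iff_of_nonneg hterm).1 hR e he
    have h2 := neg_gap_lt_theta (mem_Ico.1 he).1 (Nat.lt_succ_iff.1 (mem_Ico.1 he).2) hm
    have h3 : N e = 0 := (mul_eq_zero.1 h1).resolve_left (by linarith)
    have h4 := (sum_eq_zero_iff_of_nonneg fun A _ => sq_nonneg (lift (h e) A)).1 h3 A
      (mem_powersetCard.2 ⟨subset_univ _, hA⟩)
    exact pow_eq_zero_iff two_ne_zero |>.1 h4

lemma lift_compl_eq_zero {k m : ℕ} (hα : Fintype.card α = m + k) (hk : 2 ≤ k)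
    {F : Finset (Finset α)} (hint : ∀ A ∈ F, ∀ B ∈ F, 2 ≤ (A ∩ B).card) {w : Finset α → ℝ}
    (hw : SupportedOn 2 w) (hfw : ∀ A : Finset α, A.card = k → indicator F A = lift w A)
    {A : Finset α} (hA : A ∈ F) {Y : Finset α} (hY : (A \ Y).card ≤ 1) (hYm : Y.card ≤ m) :
    lift w Yᶜ = 0 := by
  have h1 := sum_indicator_compl_eq_zero hint k hA hY
  rw [sum_congr rfl fun B hB => hfw B (mem_powersetCard.1 hB).2, sum_powersetCard_lift hw hk] at h1
  refine (mul_eq_zero.1 h1).resolve_left ?_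
  rw [card_compl, hα]
  exact_mod_cast (Nat.choose_pos (by omega)).ne'

/-- A 2-intersecting family whose indicator function has degree at most two is contained in a
2-star. -/
lemma exists_pair_subset {k m : ℕ} (hk : 3 ≤ k) (hm : k + 1 ≤ m)
    (hα : Fintype.card α = m + k) {F : Finset (Finset α)} (hcard : ∀ A ∈ F, A.card = k)
    (hint : ∀ A ∈ F, ∀ B ∈ F, 2 ≤ (A ∩ B).card) (hne : F.Nonempty) {w : Finset α → ℝ}
    (hw : SupportedOn 2 w) (hfw : ∀ A : Finset α, A.card = k → indicator F A = lift w A) :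
    ∃ P : Finset α, P.card = 2 ∧ ∀ A ∈ F, P ⊆ A := by
  have hone : ∀ A ∈ F, lift w A = 1 := fun A hA => by
    rw [← hfw A (hcard A hA), indicator_of_mem hA]
  have hcompl : ∀ A ∈ F, lift w Aᶜ = 0 := fun A hA =>
    lift_compl_eq_zero hα (by omega) hint hw hfw hA (by simp) (by rw [hcard A hA]; omega)
  have hcompl_insert : ∀ A ∈ F, ∀ x ∈ A, lift w (insert x Aᶜ) = 0 := fun A hA x hx => by
    rw [← compl_erase]
    refine lift_compl_eq_zero hα (by omega) hint hw hfw hA ?_ ?_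
    · rw [sdiff_erase_self hx]; simp
    · have := hcard A hA
      have := card_erase_le (s := A) (a := x)
      omega
  have hdeg_compl : ∀ A ∈ F, ∀ x ∈ A, pairDegree w x Aᶜ = 0 := fun A hA x hx => by
    have := lift_insert hw (x := x) (Z := Aᶜ) (by simpa using hx)
    rw [hcompl_insert A hA x hx, hcompl A hA] at this
    linarith
  have hpair : ∀ A ∈ F, ∀ x ∈ A, ∀ y ∈ A, 0 ≤ w {x, y} := by
    intro A hA x hx y hy
    rcases eq_or_ne x y with rfl | hxy
    · rw [hw _ (by simp)]
    have h1 : lift w ((A.erase x).erase y)ᶜ = w {x, y} := by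
      rw [compl_erase, compl_erase, lift_insert hw (by simp [hxy.symm, hy]),
        hcompl_insert A hA x hx, pairDegree_insert y (by simpa using hx), hdeg_compl A hA y hy,
        pair_comm y x]
      ring
    have h2 : 0 ≤ ∑ B ∈ ((A.erase x).erase y)ᶜ.powersetCard k, indicator F B :=
      sum_nonneg fun B _ => by rw [indicator]; split_ifs <;> norm_num
    rw [sum_congr rfl fun B hB => hfw B (mem_powersetCard.1 hB).2,
      sum_powersetCard_lift hw (by omega), h1] at h2
    refine nonneg_of_mul_nonneg_right h2 ?_
    have h3 : ((A.erase x).erase y).card ≤ k :=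
      (card_le_card ((erase_subset _ _).trans (erase_subset _ _))).trans (hcard A hA).le
    rw [card_compl, hα]
    exact_mod_cast Nat.choose_pos (by omega)
  have hcover : ∀ x, ∃ A ∈ F, x ∈ A := by
    intro x
    by_contra! hx
    obtain ⟨A, hA⟩ := hne
    have hxA := hx A hA
    set C := (insert x A)ᶜ with hC
    have hxC : x ∉ C := by simp [hC]
    have hAC : Aᶜ = insert x C := by
      rw [hC, compl_insert, insert_erase (by simpa using hxA)]
    have hCA : ∀ a ∈ A, a ∉ C := fun a ha => by simp [hC, ha]
    have hC0 : lift w C = 0 := by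
      refine lift_compl_eq_zero hα (by omega) hint hw hfw hA ?_ ?_
      · rw [sdiff_eq_empty_iff_subset.2 (subset_insert x A)]; simp
      · rw [card_insert_of_notMem hxA, hcard A hA]; omega
    have hxC0 : pairDegree w x C = 0 := by
      have := lift_insert hw hxC
      rw [← hAC, hcompl A hA, hC0] at this
      linarith
    have hxa : ∀ a ∈ A, w {x, a} = 0 := by
      intro a ha
      have hne : x ≠ a := fun h => hxA (h ▸ ha)
      have h1 : lift w (insert a C) = 0 := by
        rw [hC, ← compl_erase]
        refine lift_compl_eq_zero hα (by omega) hint hw hfw hA ?_ ?_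
        · refine (card_le_card (t := {a}) ?_).trans (by simp)
          intro b hb
          simp only [mem_sdiff, mem_erase, mem_insert, not_and, mem_singleton] at hb ⊢
          by_contra hba
          exact hb.2 hba (Or.inr hb.1)
        · rw [card_erase_of_mem (mem_insert_of_mem ha), card_insert_of_notMem hxA, hcard A hA]
          omega
      have h2 := lift_insert hw (x := x) (Z := insert a C) (by simp [hne, hxC])
      rw [insert_comm, ← hAC, hcompl_insert A hA a ha, h1, pairDegree_insert x (hCA a ha),
        hxC0] at h2
      linarith
    have herase : ∀ a ∈ A, lift w (A.erase a) = 0 := by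
      intro a ha
      have hxe : x ∉ A.erase a := fun h => hxA (mem_of_mem_erase h)
      have h1 := lift_insert hw hxe
      have h2 : (insert x (A.erase a)).card = k := by
        rw [card_insert_of_notMem hxe, card_erase_of_mem ha, hcard A hA]; omega
      rw [← hfw _ h2, indicator_of_notMem fun h => hx _ h (mem_insert_self _ _), pairDegree,
        sum_eq_zero fun y hy => hxa y (mem_of_mem_erase hy)] at h1
      linarith
    have h1 := sum_lift_erase hw A
    rw [sum_eq_zero herase, hone A hA, hcard A hA] at h1
    have hk' : (3 : ℝ) ≤ k := by exact_mod_cast hk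
    push_cast at h1
    linarith
  have hsplit : ∀ A ∈ F, ∀ x, pairDegree w x univ = pairDegree w x A + pairDegree w x Aᶜ :=
    fun A _ x => (sum_add_sum_compl A _).symm
  have hdeg : ∀ A ∈ F, ∀ x ∈ A, pairDegree w x univ = pairDegree w x A := fun A hA x hx => by
    rw [hsplit A hA, hdeg_compl A hA x hx, add_zero]
  have hdeg_nonneg : ∀ x, 0 ≤ pairDegree w x univ := fun x => by
    obtain ⟨A, hA, hx⟩ := hcover x
    rw [hdeg A hA x hx]
    exact sum_nonneg fun y hy => hpair A hA x hx y hy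
  have hdeg_le : ∀ x, pairDegree w x univ ≤ 1 := fun x => by
    obtain ⟨A, hA, hx⟩ := hcover x
    have h1 := lift_eq_lift_erase_add hw hx
    have h2 : 0 ≤ lift w (A.erase x) := by
      refine sum_nonneg fun S hS => ?_
      by_cases hS2 : S.card = 2
      · obtain ⟨a, b, -, rfl⟩ := card_eq_two.1 hS2
        have hsub := (mem_powerset.1 hS).trans (erase_subset _ _)
        exact hpair A hA a (hsub (by simp)) b (hsub (by simp))
      · exact (hw S hS2).ge
    rw [hone A hA] at h1
    rw [hdeg A hA x hx]
    linarith
  have hdeg_zero : ∀ A ∈ F, ∀ x ∉ A, pairDegree w x univ = 0 := by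
    intro A hA x hx
    have h1 : ∑ x ∈ Aᶜ, pairDegree w x univ = 0 := by
      simp only [hsplit A hA, sum_add_distrib]
      rw [sum_pairDegree hw, hcompl A hA]
      simp only [pairDegree]
      rw [sum_comm, mul_zero, add_zero]
      refine sum_eq_zero fun y hy => ?_
      simp only [pair_comm _ y]
      exact hdeg_compl A hA y hy
    exact (sum_eq_zero_iff_of_nonneg fun x _ => hdeg_nonneg x).1 h1 x (by simpa using hx)
  set P₀ : Finset α := univ.filter fun x => pairDegree w x univ ≠ 0 with hP₀
  have hsub : ∀ A ∈ F, P₀ ⊆ A := fun A hA x hx => by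
    by_contra hxA
    exact (mem_filter.1 hx).2 (hdeg_zero A hA x hxA)
  have hcard₀ : 2 ≤ P₀.card := by
    obtain ⟨A, hA⟩ := hne
    have h1 : ∑ x ∈ P₀, pairDegree w x univ = 2 := by
      rw [sum_subset (hsub A hA) (fun x _ hx => by simpa [hP₀] using hx),
        sum_congr rfl fun x hx => hdeg A hA x hx, sum_pairDegree hw, hone A hA, mul_one]
    have h2 := sum_le_card_nsmul P₀ _ 1 fun x _ => hdeg_le x
    rw [h1, nsmul_eq_mul, mul_one] at h2
    exact_mod_cast h2
  obtain ⟨P, hP, hPc⟩ := exists_subset_card_eq hcard₀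
  exact ⟨P, hPc, fun A hA => hP.trans (hsub A hA)⟩

end TwoIntersecting

/-- Ahlswede–Khachatrian, `t = 2`, `r = 0` case: if `F` is a 2-intersecting family of
`k`-subsets of an `n`-set with `n ≥ 3k-2`, then `|F| ≤ C(n-2,k-2)`, with equality
iff `F` is a 2-star. -/
theorem two_intersecting_bound (n k : ℕ) (hk2 : 2 ≤ k) (hn : 3 * k - 2 ≤ n)
    (F : Finset (Finset (Fin n)))
    (hcard : ∀ A ∈ F, A.card = k)
    (hint : ∀ A ∈ F, ∀ B ∈ F, 2 ≤ (A ∩ B).card) :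
    F.card ≤ (n - 2).choose (k - 2) ∧
    (F.card = (n - 2).choose (k - 2) ↔
      ∃ P : Finset (Fin n), P.card = 2 ∧
        F = (Finset.univ.powersetCard k).filter (fun A => P ⊆ A)) := by
  have hstar : ∀ P : Finset (Fin n), P.card = 2 →
      ((univ.powersetCard k).filter (fun A => P ⊆ A)).card = (n - 2).choose (k - 2) := by
    intro P hP
    rw [card_filter_powersetCard_subset P univ k (subset_univ _) (by omega), card_univ,
      Fintype.card_fin, hP]
  suffices h : F.card ≤ (n - 2).choose (k - 2) ∧ (F.card = (n - 2).choose (k - 2) →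
      ∃ P : Finset (Fin n), P.card = 2 ∧ ∀ A ∈ F, P ⊆ A) by
    refine ⟨h.1, fun heq => ?_, ?_⟩
    · obtain ⟨P, hP, hPF⟩ := h.2 heq
      refine ⟨P, hP, eq_of_subset_of_card_le (fun A hA => mem_filter.2
        ⟨mem_powersetCard.2 ⟨subset_univ _, hcard A hA⟩, hPF A hA⟩) ?_⟩
      rw [hstar P hP, heq]
    · rintro ⟨P, hP, rfl⟩
      exact hstar P hP
  rcases hk2.eq_or_lt with rfl | hk3
  · have hle : F.card ≤ 1 := card_le_one.2 fun A hA B hB => by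
      have h1 : A ∩ B = A := eq_of_subset_of_card_le inter_subset_left
        ((hcard A hA).trans_le (hint A hA B hB))
      exact eq_of_subset_of_card_le (inter_eq_left.1 h1) (by rw [hcard A hA, hcard B hB])
    refine ⟨by simpa using hle, fun heq => ?_⟩
    obtain ⟨A, rfl⟩ := card_eq_one.1 (show F.card = 1 by simpa using heq)
    exact ⟨A, hcard A (by simp), by simp⟩
  · obtain ⟨m, rfl⟩ : ∃ m, n = m + k := ⟨n - k, by omega⟩
    have hα := Fintype.card_fin (m + k)
    have hmain := TwoIntersecting.card_le_and_exists_lift hk3 (by omega) hα hcard hint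
    refine ⟨hmain.1, fun heq => ?_⟩
    obtain ⟨w, hw, hfw⟩ := hmain.2 heq
    refine TwoIntersecting.exists_pair_subset hk3 (by omega) hα hcard hint ?_ hw hfw
    rw [← card_pos, heq]
    exact Nat.choose_pos (by omega)
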